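/- arXiv:1912.11388 — 4 statements merged into one kernel-verified Lean document; each statement's English description precedes it below -/
import Mathlib

section
/- Let n ≥ 27 be an integer and let u ∈ B* be a word with φ_n(u) equal to the identity permutation. If some factor of the circular word ⟨γ_n(u)⟩ has an exponent larger than n/(n−1), then the circular word ⟨u⟩ has a factor v satisfying one of the following conditions: (i) v is a k-stabilizing word of order n with 0 < |v| < k(n−1) for some 1 ≤ k ≤ n−1; or (ii) v is a kernel repetition of order n. -/
/-- `p` is a period of the word `w`: `p` is positive and `w[i] = w[i+p]`
whenever both indices are within `w`. -/
def HasPeriod {α : Type*} (w : List α) (p : ℕ) : Prop :=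
  0 < p ∧ ∀ i : ℕ, i + p < w.length → w[i]? = w[i + p]?

/-- `u` is a factor of the circular word `⟨w⟩`, i.e. a factor of some conjugate of `w`. -/
def IsCircularFactor {α : Type*} (u w : List α) : Prop :=
  ∃ x y : List α, w = x ++ y ∧ u <:+: (y ++ x)

/-- The equivalence between `Fin (n-1)` and the elements of `Fin n` of value `< n - 1`. -/
def finTruncEquiv (n : ℕ) : Fin (n - 1) ≃ {x : Fin n // (x : ℕ) < n - 1} where
  toFun a := ⟨⟨a.1, lt_of_lt_of_le a.2 (Nat.sub_le n 1)⟩, a.2⟩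
  invFun x := ⟨x.1.1, x.2⟩
  left_inv a := rfl
  right_inv x := rfl

/-- The permutation of `A_n = {1,…,n}` (modelled as `Fin n`, with letter `i` being
`⟨i-1⟩`) associated to a letter of `B = {0,1}`: letter `0` maps to the `(n-1)`-cycle
`(1 2 ⋯ n-1)` and letter `1` maps to the `n`-cycle `(1 2 ⋯ n)`. -/
def stepPerm (n : ℕ) (b : Fin 2) : Equiv.Perm (Fin n) :=
  if b = 0 then (finRotate (n - 1)).extendDomain (finTruncEquiv n)
  else finRotate n

/-- `phiRight n u` is the permutation `x ↦ x · φ_n(u)`, the right action of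
`φ_n(u) = φ_n(b_1)φ_n(b_2)⋯φ_n(b_k)` on `A_n` (so the letters of `u` act in order,
leftmost first).  In particular `φ_n(u)` is the identity iff `phiRight n u = 1`, and
`φ_n(u)` fixes a point iff `phiRight n u` does. -/
def phiRight (n : ℕ) (u : List (Fin 2)) : Equiv.Perm (Fin n) :=
  (u.reverse.map (stepPerm n)).prod

/-- Pansiot's encoding `γ_n : B* → A_n*`: the `i`-th letter `a_i` of `γ_n(u)` is the
unique letter with `a_i · φ_n(b_1⋯b_i) = 1` (letter `1` is `⟨0, _⟩ : Fin n`). -/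
def gammaWord (n : ℕ) (hn : 0 < n) (u : List (Fin 2)) : List (Fin n) :=
  (List.range u.length).map (fun i => (phiRight n (u.take (i + 1)))⁻¹ ⟨0, hn⟩)

/-- `v` is a `k`-stabilizing word of order `n`: `v` is nonempty and `φ_n(v)` fixes the
points `1, 2, …, k` (i.e. `⟨0⟩, …, ⟨k-1⟩ : Fin n`). -/
def IsStabilizing (n k : ℕ) (v : List (Fin 2)) : Prop :=
  v ≠ [] ∧ ∀ j : Fin n, (j : ℕ) < k → phiRight n v j = j

/-- `v` is a kernel repetition of order `n`: `v` has a period `p` and a factor `v'` of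
length `p` with `φ_n(v')` the identity and `|v| > np/(n-1) - (n-1)`. -/
def IsKernelRep (n : ℕ) (v : List (Fin 2)) : Prop :=
  ∃ p : ℕ, HasPeriod v p ∧ ∃ v' : List (Fin 2), v' <:+: v ∧ v'.length = p ∧
    phiRight n v' = 1 ∧
    (n : ℝ) * (p : ℝ) / ((n : ℝ) - 1) - ((n : ℝ) - 1) < (v.length : ℝ)

theorem phiRight_append (n : ℕ) (x y : List (Fin 2)) :
    phiRight n (x ++ y) = phiRight n y * phiRight n x := by
  simp [phiRight]

theorem length_gammaWord (n : ℕ) (hn : 0 < n) (u : List (Fin 2)) :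
    (gammaWord n hn u).length = u.length := by
  simp [gammaWord]

/-- Pansiot's encoding of a concatenation, up to relabelling of the second part. -/
theorem gammaWord_append (n : ℕ) (hn : 0 < n) (x y : List (Fin 2)) :
    gammaWord n hn (x ++ y) =
      gammaWord n hn x ++ (gammaWord n hn y).map ⇑(phiRight n x)⁻¹ := by
  unfold gammaWord
  rw [List.length_append, List.range_add, List.map_append, List.map_map, List.map_map]
  congr 1
  · refine List.map_congr_left fun i hi => ?_
    rw [List.take_append_of_le_length (by simpa using hi)]
  · refine List.map_congr_left fun i _ => ?_
    simp only [Function.comp_apply]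
    rw [add_assoc, List.take_length_add_append, phiRight_append, mul_inv_rev,
      Equiv.Perm.mul_apply]

theorem HasPeriod.of_map {α β : Type*} {f : α → β} (hf : Function.Injective f) {w : List α}
    {p : ℕ} (h : HasPeriod (w.map f) p) : HasPeriod w p := by
  refine ⟨h.1, fun i hi => ?_⟩
  have h1 := h.2 i (by simpa using hi)
  rw [List.getElem?_map, List.getElem?_map] at h1
  exact Option.map_injective hf h1

/-- Every circular factor of the encoding of a kernel word is a relabelled encoding of a
circular factor of that word. -/
theorem IsCircularFactor.exists_map_gammaWord {n : ℕ} {hn : 0 < n} {u : List (Fin 2)}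
    (hker : phiRight n u = 1) {w : List (Fin n)}
    (h : IsCircularFactor w (gammaWord n hn u)) :
    ∃ v, IsCircularFactor v u ∧ ∃ σ : Equiv.Perm (Fin n), w = (gammaWord n hn v).map σ := by
  obtain ⟨x, y, hxy, s, t, hst⟩ := h
  obtain ⟨u₁, u₂, rfl, hu₁⟩ : ∃ u₁ u₂, u = u₁ ++ u₂ ∧ u₁.length = x.length := by
    refine ⟨u.take x.length, u.drop x.length, by simp, ?_⟩
    have := congrArg List.length hxy
    rw [length_gammaWord, List.length_append] at this
    simp only [List.length_take]
    omega
  rw [gammaWord_append] at hxy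
  obtain ⟨hx, hy⟩ := List.append_inj hxy (by rw [length_gammaWord, hu₁])
  have hinv : (phiRight n u₁)⁻¹ * (phiRight n u₂)⁻¹ = 1 := by
    rw [← mul_inv_rev, ← phiRight_append, hker, inv_one]
  have hrot : y ++ x = (gammaWord n hn (u₂ ++ u₁)).map ⇑(phiRight n u₁)⁻¹ := by
    rw [gammaWord_append, List.map_append, List.map_map, ← Equiv.Perm.coe_mul, hinv, hy, hx]
    simp
  obtain ⟨a, v, c, hv, ha, hc⟩ : ∃ a v c, u₂ ++ u₁ = a ++ v ++ c ∧ a.length = s.length ∧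
      v.length = w.length := by
    have hlen := congrArg List.length (hst.trans hrot)
    rw [List.length_map, length_gammaWord, List.length_append, List.length_append] at hlen
    refine ⟨(u₂ ++ u₁).take s.length, ((u₂ ++ u₁).drop s.length).take w.length,
      ((u₂ ++ u₁).drop s.length).drop w.length, by simp, ?_, ?_⟩ <;>
    simp only [List.length_take, List.length_drop] <;> omega
  refine ⟨v, ⟨u₁, u₂, rfl, a, c, hv.symm⟩, (phiRight n u₁)⁻¹ * (phiRight n a)⁻¹, ?_⟩
  rw [← hst, hv, gammaWord_append, gammaWord_append, List.map_append, List.map_append] at hrot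
  have h1 := (List.append_inj hrot (by simp [length_gammaWord, ha, hc])).1
  have h2 := (List.append_inj h1 (by simp [length_gammaWord, ha])).2
  rw [h2, List.map_map, Equiv.Perm.coe_mul]

theorem IsCircularFactor.of_infix {α : Type*} {v w u : List α} (h : IsCircularFactor w u)
    (hv : v <:+: w) : IsCircularFactor v u := by
  obtain ⟨x, y, hxy, hw⟩ := h
  exact ⟨x, y, hxy, hv.trans hw⟩

theorem stepPerm_zero_apply {n : ℕ} {j : Fin n} (h : (j : ℕ) < n - 1) :
    ((stepPerm n 0 j : Fin n) : ℕ) = if (j : ℕ) + 1 < n - 1 then (j : ℕ) + 1 else 0 := by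
  obtain ⟨m, rfl⟩ : ∃ m, n = m + 2 := ⟨n - 2, by omega⟩
  have h1 : stepPerm (m + 2) 0 j = (finRotate (m + 1)).extendDomain (finTruncEquiv (m + 2)) j := by
    simp [stepPerm]
  rw [h1, Equiv.Perm.extendDomain_apply_subtype _ (finTruncEquiv (m + 2)) h]
  change ((finRotate (m + 1) ⟨j, h⟩ : Fin (m + 1)) : ℕ) = _
  split_ifs with h2
  · rw [finRotate_of_lt (by omega)]
  · have h3 : (⟨j, h⟩ : Fin (m + 1)) = Fin.last m := by
      ext
      simp only [Fin.val_last]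
      omega
    rw [h3, finRotate_last]
    rfl

theorem stepPerm_one_apply {n : ℕ} {j : Fin n} (h : (j : ℕ) < n - 1) :
    ((stepPerm n 1 j : Fin n) : ℕ) = (j : ℕ) + 1 := by
  obtain ⟨m, rfl⟩ : ∃ m, n = m + 1 := ⟨n - 1, by omega⟩
  obtain ⟨j, hj⟩ := j
  simp only [stepPerm, one_ne_zero, if_false]
  rw [finRotate_of_lt (by simpa using h)]

/-- A short word moves the first point forward by its length. -/
theorem phiRight_apply_zero {n : ℕ} (hn : 0 < n) (s : List (Fin 2)) (hs : s.length < n - 1) :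
    ((phiRight n s ⟨0, hn⟩ : Fin n) : ℕ) = s.length := by
  induction s using List.reverseRecOn with
  | nil => simp [phiRight]
  | append_singleton s b ih =>
    rw [List.length_append, List.length_singleton] at hs ⊢
    have ih := ih (by omega)
    rw [phiRight_append, Equiv.Perm.mul_apply]
    have hb : phiRight n [b] = stepPerm n b := by simp [phiRight]
    rw [hb]
    fin_cases b
    · exact (stepPerm_zero_apply (by omega)).trans (by rw [ih, if_pos hs])
    · exact (stepPerm_one_apply (by omega)).trans (by rw [ih])

theorem gammaWord_getElem? {n : ℕ} (hn : 0 < n) {u : List (Fin 2)} {i : ℕ} (hi : i < u.length) :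
    (gammaWord n hn u)[i]? = some ((phiRight n (u.take (i + 1)))⁻¹ ⟨0, hn⟩) := by
  simp [gammaWord, List.getElem?_range hi]

/-- The last letters of an encoding are the preimages of the first points. -/
theorem gammaWord_getElem?_recent {n : ℕ} (hn : 0 < n) {u : List (Fin 2)} {t : ℕ} {j : Fin n}
    (hj : (j : ℕ) < n - 1) (hjt : (j : ℕ) < t) (ht : t ≤ u.length) :
    (gammaWord n hn u)[t - 1 - j]? = some ((phiRight n (u.take t))⁻¹ j) := by
  rw [gammaWord_getElem? hn (by omega), Option.some_inj, eq_comm, Equiv.Perm.inv_eq_iff_eq]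
  have hsplit : u.take t = u.take (t - 1 - j + 1) ++ (u.drop (t - 1 - j + 1)).take j := by
    rw [← List.take_add]
    congr 1
    omega
  rw [hsplit, phiRight_append, Equiv.Perm.mul_apply, Equiv.Perm.inv_def,
    Equiv.apply_symm_apply]
  have hlen : ((u.drop (t - 1 - j + 1)).take j).length = j := by
    simp only [List.length_take, List.length_drop]
    omega
  ext
  rw [phiRight_apply_zero hn _ (by omega), hlen]

/-- A letter of a word is recovered from its encoding by comparing letters at distance
`n - 1`. -/
theorem getElem?_eq_zero_iff {n : ℕ} (hn : 2 ≤ n) {u : List (Fin 2)} {i : ℕ}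
    (hi : i + (n - 1) < u.length) :
    u[i + (n - 1)]? = some 0 ↔
      (gammaWord n (by omega) u)[i]? = (gammaWord n (by omega) u)[i + (n - 1)]? := by
  have h1 := gammaWord_getElem?_recent (n := n) (by omega) (u := u) (t := i + (n - 1))
    (j := ⟨n - 2, by omega⟩) (by simp only; omega) (by simp only; omega) (by omega)
  have hidx : i + (n - 1) - 1 - (n - 2) = i := by omega
  simp only [hidx] at h1
  rw [h1, gammaWord_getElem? _ hi, List.take_add_one, List.getElem?_eq_getElem hi,
    phiRight_append, mul_inv_rev, Equiv.Perm.mul_apply, Option.some_inj, Option.some_inj,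
    Equiv.apply_eq_iff_eq, eq_comm (a := (⟨n - 2, _⟩ : Fin n)), Equiv.Perm.inv_eq_iff_eq]
  have hb (b : Fin 2) : phiRight n [b] = stepPerm n b := by simp [phiRight]
  rw [Option.toList_some, hb]
  generalize u[i + (n - 1)] = b
  fin_cases b
  · refine iff_of_true rfl (Fin.ext ?_)
    refine ((stepPerm_zero_apply ?_).trans ?_).symm
    · simp only; omega
    · simp only; rw [if_neg (by omega)]
  · refine iff_of_false (by decide) fun h => ?_
    have h2 := congrArg Fin.val h
    have h3 := stepPerm_one_apply (n := n) (j := ⟨n - 2, by omega⟩) (by simp only; omega)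
    change 0 = ((stepPerm n 1 ⟨n - 2, by omega⟩ : Fin n) : ℕ) at h2
    omega

/-- A period of the encoding is a period of the word after its first `n - 1` letters. -/
theorem HasPeriod.drop_of_gammaWord {n : ℕ} (hn : 2 ≤ n) {v : List (Fin 2)} {p : ℕ}
    (h : HasPeriod (gammaWord n (by omega) v) p) : HasPeriod (v.drop (n - 1)) p := by
  refine ⟨h.1, fun i hi => ?_⟩
  rw [List.length_drop] at hi
  have h1 := h.2 i (by rw [length_gammaWord]; omega)
  have h2 := h.2 (i + (n - 1)) (by rw [length_gammaWord]; omega)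
  have e1 := getElem?_eq_zero_iff hn (u := v) (i := i) (by omega)
  have e2 := getElem?_eq_zero_iff hn (u := v) (i := i + p) (by omega)
  rw [add_right_comm] at h2
  rw [h1, h2, ← e2] at e1
  rw [List.getElem?_drop, List.getElem?_drop, add_comm (n - 1), add_comm (n - 1)]
  rw [List.getElem?_eq_getElem (by omega), List.getElem?_eq_getElem (by omega)] at e1 ⊢
  rw [Option.some_inj] at e1 ⊢
  rw [Option.some_inj] at e1
  generalize v[i + (n - 1)] = b at e1
  generalize v[i + p + (n - 1)] = c at e1
  revert b c
  decide

/-- If the encoding of `v` has period `p`, the word of length `p` read from position `k` on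
fixes the first `k` points. -/
theorem phiRight_apply_of_hasPeriod {n : ℕ} (hn : 0 < n) {v : List (Fin 2)} {p k : ℕ}
    (h : HasPeriod (gammaWord n hn v) p) (hk : k ≤ n - 1) (hkv : k + p ≤ v.length)
    {j : Fin n} (hj : (j : ℕ) < k) : phiRight n ((v.drop k).take p) j = j := by
  have h1 := gammaWord_getElem?_recent hn (u := v) (t := k) (j := j) (by omega) hj (by omega)
  have h2 := gammaWord_getElem?_recent hn (u := v) (t := k + p) (j := j) (by omega) (by omega) hkv
  have h3 := h.2 (k - 1 - j) (by rw [length_gammaWord]; omega)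
  have hidx : k - 1 - (j : ℕ) + p = k + p - 1 - j := by omega
  rw [hidx, h1, h2, Option.some_inj, List.take_add, phiRight_append, mul_inv_rev,
    Equiv.Perm.mul_apply, Equiv.apply_eq_iff_eq, eq_comm, Equiv.Perm.inv_eq_iff_eq] at h3
  exact h3.symm

theorem perm_eq_one_of_fixes_init {n : ℕ} {σ : Equiv.Perm (Fin n)}
    (h : ∀ j : Fin n, (j : ℕ) < n - 1 → σ j = j) : σ = 1 := by
  ext j
  rw [Equiv.Perm.one_apply]
  by_cases hj : (j : ℕ) < n - 1
  · rw [h j hj]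
  · by_cases hs : ((σ j : Fin n) : ℕ) < n - 1
    · rw [σ.injective (h _ hs)]
    · omega

/-- The circular analogue of Carpi's reformulation: for `n ≥ 27` and `u` in the kernel
of `φ_n`, if a factor of the circular word `⟨γ_n(u)⟩` has an exponent larger than
`n/(n-1)`, then the circular word `⟨u⟩` has a factor `v` which is either a
`k`-stabilizing word with `0 < |v| < k(n-1)` for some `1 ≤ k ≤ n-1`, or a kernel
repetition of order `n`. -/
theorem circular_carpi_reformulation (n : ℕ) (hn : 27 ≤ n) (u : List (Fin 2))
    (hker : phiRight n u = 1)
    (h : ∃ w : List (Fin n), ∃ p : ℕ, IsCircularFactor w (gammaWord n (by omega) u) ∧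
      HasPeriod w p ∧ (n : ℝ) / ((n : ℝ) - 1) < (w.length : ℝ) / (p : ℝ)) :
    ∃ v : List (Fin 2), IsCircularFactor v u ∧
      ((∃ k : ℕ, 1 ≤ k ∧ k ≤ n - 1 ∧ IsStabilizing n k v ∧
          0 < v.length ∧ v.length < k * (n - 1)) ∨
        IsKernelRep n v) := by
  obtain ⟨w, p, hw, hper, hexp⟩ := h
  obtain ⟨v, hv, σ, rfl⟩ := hw.exists_map_gammaWord hker
  replace hper := hper.of_map σ.injective
  have hp : 0 < p := hper.1
  rw [List.length_map, length_gammaWord] at hexp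
  have hn1 : (0 : ℝ) < (n : ℝ) - 1 := by
    have : (27 : ℝ) ≤ n := by exact_mod_cast hn
    linarith
  have hpR : (0 : ℝ) < p := by exact_mod_cast hp
  rw [div_lt_div_iff₀ hn1 hpR] at hexp
  have hexp' : n * p < v.length * (n - 1) := by
    have : ((n - 1 : ℕ) : ℝ) = (n : ℝ) - 1 := by
      rw [Nat.cast_sub (by omega), Nat.cast_one]
    rw [← this] at hexp
    exact_mod_cast hexp
  have hpv : p < v.length := by
    by_contra! hle
    have := Nat.mul_le_mul hle (Nat.sub_le n 1)
    rw [mul_comm p n] at this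
    omega
  have infix_of (k : ℕ) : (v.drop k).take p <:+: v :=
    (List.take_prefix _ _).isInfix.trans (List.drop_suffix _ _).isInfix
  have length_of {k : ℕ} (hk : k + p ≤ v.length) : ((v.drop k).take p).length = p := by
    simp only [List.length_take, List.length_drop]
    omega
  obtain ⟨e, he⟩ : ∃ e, v.length = e + p := ⟨v.length - p, by omega⟩
  by_cases hen : e ≤ n - 1
  · have hlen := length_of he.ge
    refine ⟨(v.drop e).take p, hv.of_infix (infix_of e), Or.inl
      ⟨e, by omega, hen, ⟨List.ne_nil_of_length_pos (by omega), fun j hj => ?_⟩, by omega, ?_⟩⟩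
    · exact phiRight_apply_of_hasPeriod _ hper hen he.ge hj
    · rw [hlen]
      obtain ⟨m, rfl⟩ : ∃ m, n = m + 1 := ⟨n - 1, by omega⟩
      rw [he, Nat.add_sub_cancel] at hexp'
      rw [Nat.add_sub_cancel]
      linarith
  · have hlen := length_of (k := n - 1) (by omega)
    refine ⟨v.drop (n - 1), hv.of_infix (List.drop_suffix _ _).isInfix, Or.inr
      ⟨p, hper.drop_of_gammaWord (by omega), (v.drop (n - 1)).take p,
        (List.take_prefix _ _).isInfix, hlen, ?_, ?_⟩⟩
    · exact perm_eq_one_of_fixes_init fun j hj =>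
        phiRight_apply_of_hasPeriod _ hper le_rfl (by omega) hj
    · rw [List.length_drop, Nat.cast_sub (by omega), Nat.cast_sub (by omega), Nat.cast_one,
        sub_lt_sub_iff_right, div_lt_iff₀ hn1]
      exact hexp
end

section
/- For every integer k ≥ 1, the infinite word β has a factor of length k that begins with the letter 2 and ends with the letter 2; that is, there exists an index i ≥ 1 such that b_i = 2 and b_{i+k−1} = 2. -/
/-- The infinite word `β = (b_i)_{i ≥ 1}` over `{1,2}`: `b_i = 1` if `i ≡ 1 (mod 3)`,
`b_i = 2` if `i ≡ 2 (mod 3)`, and `b_i = b_{i/3}` if `i ≡ 0 (mod 3)`.  (The value at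
the unused index `0` is set to `1`.) -/
def betaWord (i : ℕ) : ℕ :=
  if i % 3 = 1 then 1
  else if i % 3 = 2 then 2
  else if h : i = 0 then 1
  else betaWord (i / 3)
decreasing_by exact Nat.div_lt_self (Nat.pos_of_ne_zero h) (by norm_num)

theorem betaWord_of_mod_three_eq_two {n : ℕ} (h : n % 3 = 2) : betaWord n = 2 := by
  rw [betaWord]
  simp [h]

theorem betaWord_of_mod_nine_eq_six {n : ℕ} (h : n % 9 = 6) : betaWord n = 2 := by
  rw [betaWord, if_neg (by omega), if_neg (by omega), dif_neg (by omega)]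
  exact betaWord_of_mod_three_eq_two (by omega)

/-- For every `k ≥ 1`, the word `β` has a factor of length `k` that begins and ends in
the letter `2`: there is an index `i ≥ 1` with `b_i = 2` and `b_{i+k-1} = 2`. -/
theorem beta_factor_begins_ends_two (k : ℕ) (hk : 1 ≤ k) :
    ∃ i : ℕ, 1 ≤ i ∧ betaWord i = 2 ∧ betaWord (i + k - 1) = 2 := by
  have h : k % 3 = 1 ∨ k % 3 = 0 ∨ k % 9 = 2 ∨ k % 9 = 5 ∨ k % 9 = 8 := by omega
  rcases h with h | h | h | h | h
  · exact ⟨2, by omega, betaWord_of_mod_three_eq_two rfl,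
      betaWord_of_mod_three_eq_two (by omega)⟩
  · exact ⟨6, by omega, betaWord_of_mod_nine_eq_six rfl,
      betaWord_of_mod_three_eq_two (by omega)⟩
  · exact ⟨5, by omega, betaWord_of_mod_three_eq_two rfl,
      betaWord_of_mod_nine_eq_six (by omega)⟩
  · exact ⟨2, by omega, betaWord_of_mod_three_eq_two rfl,
      betaWord_of_mod_nine_eq_six (by omega)⟩
  · exact ⟨8, by omega, betaWord_of_mod_three_eq_two rfl,
      betaWord_of_mod_nine_eq_six (by omega)⟩
end

section
/- Let m ≥ 4 and t ≥ 1 be integers, set M = 4^{m−2}, let x ∈ Λ_t, and let v be a factor of the circular word ⟨x⟩. If 4 divides |v|_a for every letter a ∈ A_m, then M divides |v|. -/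
/-- `max {a ∈ A_m : 4^(a-3) divides i}` (here letters are the natural numbers
`1, …, m`). -/
def lambdaLetter (m i : ℕ) : ℕ :=
  ((Finset.Icc 1 m).filter (fun a => 4 ^ (a - 3) ∣ i)).sup id

/-- Membership in the set `Λ_t` of words `x = x_0 x_1 ⋯ x_{Mt-1}` over `A_m`
(with `M = 4^(m-2)`) such that `x_i = max {a ∈ A_m : 4^(a-3) ∣ i}` whenever
`i ≡ 0 (mod 4)`, and `x_i ∈ {1,2,3}` whenever `i ≢ 0 (mod 4)`. -/
def InLambda (m t : ℕ) (x : List ℕ) : Prop :=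
  x.length = 4 ^ (m - 2) * t ∧
  ∀ i : ℕ, ∀ h : i < x.length,
    (i % 4 = 0 → x[i] = lambdaLetter m i) ∧
    (i % 4 ≠ 0 → x[i] = 1 ∨ x[i] = 2 ∨ x[i] = 3)

theorem lambdaLetter_le (m i : ℕ) : lambdaLetter m i ≤ m := by
  refine Finset.sup_le fun a ha => ?_
  exact (Finset.mem_Icc.1 (Finset.mem_filter.1 ha).1).2

theorem le_lambdaLetter_iff {m k i : ℕ} (hk : 1 ≤ k) (hkm : k ≤ m) :
    k ≤ lambdaLetter m i ↔ 4 ^ (k - 3) ∣ i := by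
  unfold lambdaLetter
  constructor
  · intro h
    obtain ⟨a, ha, hka⟩ := (Finset.le_sup_iff (by simp; omega)).1 h
    exact (pow_dvd_pow 4 (Nat.sub_le_sub_right hka 3)).trans (Finset.mem_filter.1 ha).2
  · intro h
    exact Finset.le_sup (f := id) (Finset.mem_filter.2 ⟨Finset.mem_Icc.2 ⟨hk, hkm⟩, h⟩)

theorem InLambda.letter_mem_Icc {m t : ℕ} {x : List ℕ} (hm : 3 ≤ m) (hx : InLambda m t x) {i : ℕ}
    (h : i < x.length) : 1 ≤ x[i] ∧ x[i] ≤ m := by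
  obtain ⟨h0, h1⟩ := hx.2 i h
  by_cases hi : i % 4 = 0
  · rw [h0 hi]
    exact ⟨(le_lambdaLetter_iff le_rfl (by omega)).2 (by simp), lambdaLetter_le m i⟩
  · have := h1 hi
    omega

theorem InLambda.le_letter_iff {m t : ℕ} {x : List ℕ} (hx : InLambda m t x) {i j : ℕ}
    (h : i < x.length) (hj : 1 ≤ j) (hjm : j + 3 ≤ m) : j + 3 ≤ x[i] ↔ 4 ^ j ∣ i := by
  obtain ⟨h0, h1⟩ := hx.2 i h
  by_cases hi : i % 4 = 0
  · rw [h0 hi, le_lambdaLetter_iff (by omega) hjm, Nat.add_sub_cancel]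
  · have := h1 hi
    have h4 : ¬ 4 ^ j ∣ i := fun hd =>
      hi (Nat.mod_eq_zero_of_dvd ((dvd_pow_self 4 (by omega)).trans hd))
    exact iff_of_false (by omega) h4

/-- The letters of a factor of a circular word are read off at consecutive positions modulo the
length of the word. -/
theorem IsCircularFactor.exists_getElem_eq {α : Type*} {u w : List α} (h : IsCircularFactor u w) :
    ∃ p : ℕ, ∀ i, ∀ hi : i < u.length,
      ∃ hw : (p + i) % w.length < w.length, u[i] = w[(p + i) % w.length] := by
  obtain ⟨x, y, rfl, s, r, hs⟩ := h
  refine ⟨x.length + s.length, fun i hi => ?_⟩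
  have hlen : s.length + i < (y ++ x).length := by
    rw [← hs]; simp; omega
  have hpos : 0 < (x ++ y).length := by simp at hlen ⊢; omega
  refine ⟨Nat.mod_lt _ hpos, ?_⟩
  have h1 : u[i] = (y ++ x)[s.length + i] := by
    simp [← hs, hi]
  have h2 : (y ++ x)[s.length + i]? = (x ++ y)[(s.length + i + x.length) % (x ++ y).length]? := by
    rw [← List.rotate_append_length_eq x y, List.getElem?_rotate]
    simp at hlen ⊢; omega
  have h3 : s.length + i + x.length = x.length + s.length + i := by omega
  rw [h3, List.getElem?_eq_getElem hlen, List.getElem?_eq_getElem (Nat.mod_lt _ hpos)] at h2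
  rw [h1]
  exact Option.some.inj h2

theorem countP_eq_of_forall_dvd_iff {α : Type*} (P : α → Prop) [DecidablePred P] {v : List α}
    {d n p : ℕ} (hd : 0 < d) (hlen : v.length = d * n)
    (h : ∀ i, ∀ hi : i < v.length, P v[i] ↔ d ∣ p + i) :
    v.countP (fun a => P a) = n := by
  have hv : v.countP (fun a => P a) = v.length.count (· ≡ p * (d - 1) [MOD d]) := by
    have hmap : v.map (fun a => decide (P a)) =
        (List.range v.length).map (fun i => decide (i ≡ p * (d - 1) [MOD d])) := by
      refine List.ext_getElem (by simp) fun i h1 h2 => ?_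
      have hi : i < v.length := by simpa using h1
      simp only [List.getElem_map, List.getElem_range, decide_eq_decide]
      rw [h i hi, ← Nat.modEq_zero_iff_dvd]
      have hp : p + p * (d - 1) ≡ 0 [MOD d] := by
        obtain ⟨e, rfl⟩ := Nat.exists_eq_add_of_lt hd
        exact Nat.modEq_zero_iff_dvd.2 ⟨p, by simp; ring⟩
      exact ⟨fun hi => Nat.ModEq.add_left_cancel' p (hi.trans hp.symm),
        fun hi => (hi.add_left p).trans hp⟩
    have := congrArg (List.countP id) hmap
    rw [List.countP_map, List.countP_map] at this
    simpa [Nat.count, Function.comp_def] using this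
  rw [hv, Nat.count_modEq_card _ hd, hlen]
  simp [hd]

theorem dvd_countP_le {d m : ℕ} {v : List ℕ} (hle : ∀ a ∈ v, a ≤ m)
    (hdiv : ∀ a : ℕ, 1 ≤ a → a ≤ m → d ∣ v.count a) {k : ℕ} (hk : 1 ≤ k) (hkm : k ≤ m + 1) :
    d ∣ v.countP (fun a => k ≤ a) := by
  induction hkm using Nat.decreasingInduction with
  | self =>
    have : v.countP (fun a => m + 1 ≤ a) = 0 := by
      refine List.countP_eq_zero.2 fun a ha => ?_
      have := hle a ha
      simp; omega
    rw [this]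
    exact dvd_zero d
  | of_succ k hkm ih =>
    have hsplit : v.countP (fun a => k ≤ a) = v.count k + v.countP (fun a => k + 1 ≤ a) := by
      clear hle hdiv ih
      induction v with
      | nil => simp
      | cons b v ih =>
        simp only [List.countP_cons, List.count_cons, ih, decide_eq_true_eq, beq_iff_eq]
        split_ifs <;> omega
    rw [hsplit]
    exact dvd_add (hdiv k hk (by omega)) (ih (by omega))

/-- Let `m ≥ 4`, `t ≥ 1`, `M = 4^(m-2)`, `x ∈ Λ_t`, and let `v` be a factor of the
circular word `⟨x⟩`.  If `4` divides `|v|_a` for every letter `a ∈ A_m`, then `M`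
divides `|v|`. -/
theorem lambda_kernel_length (m t : ℕ) (hm : 4 ≤ m) (ht : 1 ≤ t)
    (x v : List ℕ) (hx : InLambda m t x) (hv : IsCircularFactor v x)
    (hdiv : ∀ a : ℕ, 1 ≤ a → a ≤ m → 4 ∣ v.count a) :
    4 ^ (m - 2) ∣ v.length := by
  obtain ⟨p, hp⟩ := hv.exists_getElem_eq
  have hmem : ∀ a ∈ v, 1 ≤ a ∧ a ≤ m := by
    intro a ha
    obtain ⟨i, hi, rfl⟩ := List.getElem_of_mem ha
    obtain ⟨hw, he⟩ := hp i hi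
    rw [he]
    exact hx.letter_mem_Icc (by omega) hw
  have hcount : ∀ k, 1 ≤ k → k ≤ m + 1 → 4 ∣ v.countP (fun a => k ≤ a) := fun k =>
    dvd_countP_le (fun a ha => (hmem a ha).2) hdiv
  have hpow : ∀ j, j + 2 ≤ m → 4 ^ j ∣ v.length := by
    intro j
    induction j with
    | zero => simp
    | succ j ih =>
      intro hj
      obtain rfl | hj0 := Nat.eq_zero_or_pos j
      · have hall : v.countP (fun a => 1 ≤ a) = v.length :=
          List.countP_eq_length.2 fun a ha => by simpa using (hmem a ha).1
        simpa [hall] using hcount 1 le_rfl (by omega)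
      · obtain ⟨n, hn⟩ := ih (by omega)
        have hN : v.countP (fun a => j + 3 ≤ a) = n := by
          refine countP_eq_of_forall_dvd_iff (p := p) _ (by positivity) hn fun i hi => ?_
          obtain ⟨hw, he⟩ := hp i hi
          have hdx : 4 ^ j ∣ x.length := by
            rw [hx.1]
            exact (pow_dvd_pow 4 (by omega)).mul_right t
          rw [he, hx.le_letter_iff hw hj0 (by omega), Nat.dvd_mod_iff hdx]
        have h4 := hcount (j + 3) (by omega) (by omega)
        rw [hN] at h4
        rw [hn, pow_succ]
        exact mul_dvd_mul_left _ h4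
  exact hpow (m - 2) (by omega)
end

section
/- Let n ≥ 45 be an integer, set m = ⌊(n−3)/6⌋ and M = 4^{m−2}. Then for every integer t ≥ 1, there exists a word w over A_m of length Mt such that 4 divides |w|_a for every letter a ∈ A_m, and such that no factor v of the circular word ⟨w⟩ has the following property: v has a period q and a factor v' of length q such that 4 divides |v'|_a for every letter a ∈ A_m and (n−1)(|v|+1) ≥ nq − 3. -/
/-- The last nonzero ternary digit of `i`. -/
def lastTernaryDigit (i : ℕ) : ℕ := i / 3 ^ padicValNat 3 i % 3

/-- The letter at position `i`: a base-`4` ruler sequence truncated at level `k` on the multiples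
of `4`, the last nonzero ternary digit on odd positions, and on the remaining positions
a marker telling whether `i < H`. -/
def rulerLetter (k H i : ℕ) : ℕ :=
  if i % 4 = 0 then Nat.findGreatest (fun j => 4 ^ j ∣ i) k + 2
  else if i % 2 = 1 then lastTernaryDigit i
  else if i < H then 1 else 2

lemma lastTernaryDigit_pow_mul (j a : ℕ) (ha : ¬ 3 ∣ a) :
    lastTernaryDigit (3 ^ j * a) = a % 3 := by
  have h0 : a ≠ 0 := by rintro rfl; simp at ha
  have : padicValNat 3 (3 ^ j * a) = j := by
    rw [padicValNat.mul (by positivity) h0, padicValNat.prime_pow,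
      padicValNat.eq_zero_of_not_dvd ha, add_zero]
  rw [lastTernaryDigit, this, Nat.mul_div_cancel_left _ (by positivity)]

lemma lastTernaryDigit_eq_one_or_two {i : ℕ} (hi : i ≠ 0) :
    lastTernaryDigit i = 1 ∨ lastTernaryDigit i = 2 := by
  obtain ⟨j, a, ha, rfl⟩ := Nat.exists_eq_pow_mul_and_not_dvd hi 3 (by norm_num)
  rw [lastTernaryDigit_pow_mul j a ha]
  omega

lemma exists_modEq_mem_window (x z T : ℕ) (hT : 0 < T) :
    ∃ y, x ≤ y ∧ y < x + T ∧ y ≡ z [MOD T] := by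
  refine ⟨x + (z + (T - 1) * x) % T, by omega,
    by have := Nat.mod_lt (z + (T - 1) * x) hT; omega, ?_⟩
  calc x + (z + (T - 1) * x) % T ≡ x + (z + (T - 1) * x) [MOD T] :=
        Nat.ModEq.add_left _ (Nat.mod_modEq _ _)
    _ = z + T * x := by
        obtain ⟨T, rfl⟩ : ∃ S, T = S + 1 := ⟨T - 1, by omega⟩
        simp only [Nat.add_sub_cancel]; ring
    _ ≡ z [MOD T] := by simp [Nat.ModEq]

/-- A shift by `D = 3 ^ j * D'` with `3 ∤ D'` changes the last nonzero ternary digit of some odd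
number in each window of length `6 * 3 ^ j`. -/
lemma exists_lastTernaryDigit_ne (x j D' : ℕ) (hD : ¬ 3 ∣ D') :
    ∃ y, x ≤ y ∧ y < x + 6 * 3 ^ j ∧ y % 2 = 1 ∧
      lastTernaryDigit y ≠ lastTernaryDigit (y + 3 ^ j * D') := by
  have hodd : 3 ^ j % 2 = 1 := by
    rw [Nat.pow_mod]; simp
  obtain ⟨z, hz, hz2⟩ : ∃ c, c % 3 = D' % 3 ∧ c % 2 = 1 := by
    rcases (by omega : D' % 3 = 1 ∨ D' % 3 = 2) with h | h
    · exact ⟨1, by omega, rfl⟩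
    · exact ⟨5, by omega, rfl⟩
  obtain ⟨y, hxy, hy, hmod⟩ := exists_modEq_mem_window x (3 ^ j * z) (3 ^ j * 6) (by positivity)
  have hdvd : 3 ^ j ∣ y :=
    (hmod.dvd_iff (Dvd.intro _ rfl)).2 (Dvd.intro _ rfl)
  obtain ⟨u, rfl⟩ := hdvd
  have hu : u ≡ z [MOD 6] := Nat.ModEq.mul_left_cancel' (by positivity) hmod
  have hu3 : u % 3 = z % 3 := by unfold Nat.ModEq at hu; omega
  have hu2 : u % 2 = z % 2 := by unfold Nat.ModEq at hu; omega
  refine ⟨3 ^ j * u, hxy, by omega, ?_, ?_⟩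
  · rw [Nat.mul_mod, hodd, hu2, hz2]
  · rw [← mul_add, lastTernaryDigit_pow_mul _ _ (by omega),
      lastTernaryDigit_pow_mul _ _ (by omega)]
    omega

lemma rulerLetter_eq_iff {k H i j : ℕ} (hj : 1 ≤ j) (hjk : j ≤ k) :
    rulerLetter k H i = j + 2 ↔ 4 ^ j ∣ i ∧ (j < k → ¬ 4 ^ (j + 1) ∣ i) := by
  unfold rulerLetter
  have h4 : 4 ^ j ∣ i → i % 4 = 0 := fun h =>
    Nat.mod_eq_zero_of_dvd ((dvd_pow_self 4 (by omega)).trans h)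
  split_ifs with h0 h1 h2
  · rw [Nat.add_right_cancel_iff, Nat.findGreatest_eq_iff]
    constructor
    · rintro ⟨-, h, h'⟩
      exact ⟨h (by omega), fun hlt => h' (by omega) (by omega)⟩
    · rintro ⟨h, h'⟩
      exact ⟨hjk, fun _ => h, fun a ha hak hd =>
        h' (by omega) ((pow_dvd_pow 4 (by omega)).trans hd)⟩
  · have := lastTernaryDigit_eq_one_or_two (i := i) (by omega)
    exact ⟨fun h => by omega, fun h => absurd (h4 h.1) h0⟩
  · exact ⟨fun h => by omega, fun h => absurd (h4 h.1) h0⟩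
  · exact ⟨fun h => by omega, fun h => absurd (h4 h.1) h0⟩

lemma three_le_rulerLetter_iff {k H i : ℕ} (hk : 1 ≤ k) :
    3 ≤ rulerLetter k H i ↔ 4 ∣ i := by
  unfold rulerLetter
  split_ifs with h0 h1 h2
  · have : 1 ≤ Nat.findGreatest (fun j => 4 ^ j ∣ i) k :=
      Nat.le_findGreatest hk (by simpa using Nat.dvd_of_mod_eq_zero h0)
    omega
  · have := lastTernaryDigit_eq_one_or_two (i := i) (by omega)
    omega
  · omega
  · omega

lemma rulerLetter_mem_Icc (k H i : ℕ) : 1 ≤ rulerLetter k H i ∧ rulerLetter k H i ≤ k + 2 := by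
  unfold rulerLetter
  have := Nat.findGreatest_le (P := fun j => 4 ^ j ∣ i) k
  split_ifs with h0 h1 h2
  · omega
  · have := lastTernaryDigit_eq_one_or_two (i := i) (by omega)
    omega
  · omega
  · omega

lemma card_filter_dvd_Ico (d x q : ℕ) (hd : 0 < d) :
    ((Finset.Ico x (x + q)).filter (d ∣ ·)).card + (x + d - 1) / d = (x + q + d - 1) / d := by
  induction q with
  | zero => simp
  | succ q ih =>
    have h : x + (q + 1) + d - 1 = (x + q + d - 1) + 1 := by omega
    have h' : x + q + d - 1 + 1 = x + q + d := by omega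
    rw [h, Nat.succ_div, h', ← ih, ← add_assoc,
      ← Finset.insert_Ico_right_eq_Ico_add_one (by omega), Finset.filter_insert]
    have : d ∣ x + q + d ↔ d ∣ x + q := by simp
    simp only [this]
    split_ifs
    · rw [Finset.card_insert_of_notMem (by simp)]
      omega
    · omega

lemma card_filter_dvd_Ico_step (j x q : ℕ)
    (h : 4 ∣ ((Finset.Ico x (x + q)).filter (4 ^ j ∣ ·)).card) :
    ((Finset.Ico x (x + q)).filter (4 ^ j ∣ ·)).card =
      4 * ((Finset.Ico x (x + q)).filter (4 ^ (j + 1) ∣ ·)).card := by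
  have key : ∀ y, (y + 4 ^ (j + 1) - 1) / 4 ^ (j + 1) = ((y + 4 ^ j - 1) / 4 ^ j + 3) / 4 := by
    intro y
    have hp : 0 < 4 ^ j := by positivity
    rw [← Nat.add_mul_div_right _ _ hp, Nat.div_div_eq_div_mul, ← pow_succ]
    congr 1
    rw [pow_succ]
    omega
  have h1 := card_filter_dvd_Ico (4 ^ j) x q (by positivity)
  have h2 := card_filter_dvd_Ico (4 ^ (j + 1)) x q (by positivity)
  rw [key, key] at h2
  omega

lemma card_filter_dvd_add_card_filter_not_dvd (s : Finset ℕ) (j : ℕ) :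
    (s.filter (4 ^ (j + 1) ∣ ·)).card + (s.filter (fun y => 4 ^ j ∣ y ∧ ¬ 4 ^ (j + 1) ∣ y)).card =
      (s.filter (4 ^ j ∣ ·)).card := by
  rw [← Finset.card_filter_add_card_filter_not (s := s.filter (4 ^ j ∣ ·))
    (fun y => 4 ^ (j + 1) ∣ y), Finset.filter_filter, Finset.filter_filter]
  congr 2
  exact Finset.filter_congr fun y _ =>
    (and_iff_right_of_imp fun h => (pow_dvd_pow 4 (Nat.le_succ j)).trans h).symm

/-- If each ruler letter occurs a multiple of four times in an interval, then the number of
multiples of `4 ^ j` in the interval is divisible by `4 ^ (k + 1 - j)`. -/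
lemma pow_dvd_card_filter_dvd {L : ℕ → ℕ} {k x q : ℕ}
    (hL : ∀ y j, 1 ≤ j → j ≤ k → (L y = j + 2 ↔ 4 ^ j ∣ y ∧ (j < k → ¬ 4 ^ (j + 1) ∣ y)))
    (hc : ∀ j, 1 ≤ j → j ≤ k → 4 ∣ ((Finset.Ico x (x + q)).filter (fun y => L y = j + 2)).card)
    (d : ℕ) (hd : d < k) :
    4 ^ (d + 1) ∣ ((Finset.Ico x (x + q)).filter (4 ^ (k - d) ∣ ·)).card := by
  induction d with
  | zero =>
    have h := hc k (by omega) le_rfl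
    simp only [hL _ k (by omega) le_rfl, lt_irrefl, false_imp_iff, and_true] at h
    simpa using h
  | succ d ih =>
    have ih := ih (by omega)
    obtain ⟨j, hj⟩ : ∃ j, j = k - (d + 1) := ⟨_, rfl⟩
    rw [show k - d = j + 1 by omega] at ih
    rw [← hj]
    have h := hc j (by omega) (by omega)
    simp only [hL _ j (by omega) (by omega), show j < k by omega, true_imp_iff] at h
    have hsum := card_filter_dvd_add_card_filter_not_dvd (Finset.Ico x (x + q)) j
    have h4 : 4 ∣ ((Finset.Ico x (x + q)).filter (4 ^ j ∣ ·)).card := by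
      rw [← hsum]
      exact dvd_add ((dvd_pow_self 4 (by omega)).trans ih) h
    rw [card_filter_dvd_Ico_step j x q h4, pow_succ' 4 (d + 1)]
    exact mul_dvd_mul_left 4 ih

lemma count_map_range' (L : ℕ → ℕ) (x q a : ℕ) :
    ((List.range' x q).map L).count a =
      ((Finset.Ico x (x + q)).filter (fun y => L y = a)).card := by
  induction q with
  | zero => simp
  | succ q ih =>
    rw [List.range'_1_concat, List.map_append, List.count_append, ih, ← add_assoc,
      ← Finset.insert_Ico_right_eq_Ico_add_one (by omega), Finset.filter_insert]
    split_ifs with h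
    · rw [Finset.card_insert_of_notMem (by simp)]
      simp [h]
    · simp [h]

/-- Factors of the circular word of `w` are read off cyclically. -/
lemma IsCircularFactor.getElem?_eq {L : ℕ → ℕ} {N : ℕ} {v : List ℕ}
    (h : IsCircularFactor v ((List.range N).map L)) :
    v.length ≤ N ∧ ∃ x, ∀ j < v.length, v[j]? = some (L ((x + j) % N)) := by
  obtain ⟨X, Y, hw, S, T, hST⟩ := h
  have hlen : X.length + Y.length = N := by
    have := congrArg List.length hw
    simpa using this.symm
  have hlen' : S.length + v.length + T.length = N := by
    have := congrArg List.length hST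
    simp only [List.length_append] at this
    omega
  refine ⟨by omega, X.length + S.length, fun j hj => ?_⟩
  have h1 : v[j]? = (Y ++ X)[S.length + j]? := by
    rw [← hST, List.append_assoc, List.getElem?_append_right (by omega),
      List.getElem?_append_left (by omega)]
    congr 1; omega
  have h2 : ∀ i < N, (X ++ Y)[i]? = some (L i) := fun i hi => by
    rw [← hw]; simp [hi]
  rw [h1]
  by_cases hc : S.length + j < Y.length
  · rw [List.getElem?_append_left hc, Nat.mod_eq_of_lt (by omega), ← h2 _ (by omega),
      List.getElem?_append_right (by omega)]
    congr 1; omega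
  · have : (X.length + S.length + j) % N = S.length + j - Y.length := by
      rw [Nat.mod_eq_sub_mod (by omega), Nat.mod_eq_of_lt (by omega)]
      omega
    rw [List.getElem?_append_right (by omega), this, ← h2 _ (by omega),
      List.getElem?_append_left (by omega)]

/-- A window of length `6 * s` does not agree with its shift by `D ≤ 4 ^ (k + 1) * s`. -/
lemma rulerLetter_window_ne {k H y₀ s d : ℕ} (hd : 1 ≤ d) (hds : d ≤ s)
    (h : ∀ y, y₀ ≤ y → y < y₀ + 6 * s →
      rulerLetter k H y = rulerLetter k H (y + 4 ^ (k + 1) * d)) : False := by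
  obtain ⟨j, a, ha, rfl⟩ := Nat.exists_eq_pow_mul_and_not_dvd (n := d) (by omega) 3 (by norm_num)
  have ha0 : 0 < a := Nat.pos_of_ne_zero (by rintro rfl; simp at ha)
  have hna : ¬ 3 ∣ 4 ^ (k + 1) * a := by
    intro hd
    rcases (Nat.prime_three.dvd_mul).1 hd with h3 | h3
    · have := Nat.prime_three.dvd_of_dvd_pow h3
      omega
    · exact ha h3
  obtain ⟨y, hy1, hy2, hodd, hne⟩ := exists_lastTernaryDigit_ne y₀ j _ hna
  have hjs : 3 ^ j ≤ s := le_trans (Nat.le_mul_of_pos_right _ ha0) hds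
  have e : 4 ^ (k + 1) * (3 ^ j * a) = 3 ^ j * (4 ^ (k + 1) * a) := by ring
  have hshift := h y hy1 (by omega)
  have e4 : 4 ^ (k + 1) * (3 ^ j * a) = 4 * (4 ^ k * (3 ^ j * a)) := by ring
  apply hne
  rw [← e]
  unfold rulerLetter at hshift
  rwa [if_neg (by omega), if_pos hodd, if_neg (by omega), if_pos (by omega)] at hshift

/-- In the circular word of length `4 ^ (k + 1) * t`, a shift by `4 ^ (k + 1) * s` never agrees
with the word on a window whose length `e` is at least `19 * s - 1`. -/
lemma rulerLetter_circular_window_ne {k H t s x e : ℕ} (hk : 4 ≤ k)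
    (hH : 4 ^ (k + 1) * t ≤ 2 * H) (hH' : 2 * H ≤ 4 ^ (k + 1) * t + 24)
    (hs : 1 ≤ s) (hx : x < 4 ^ (k + 1) * t) (he : 19 * s ≤ e + 1)
    (hlen : 4 ^ (k + 1) * s + e ≤ 4 ^ (k + 1) * t)
    (h : ∀ j < e, rulerLetter k H ((x + j) % (4 ^ (k + 1) * t)) =
      rulerLetter k H ((x + 4 ^ (k + 1) * s + j) % (4 ^ (k + 1) * t))) : False := by
  have hst : s < t := by
    by_contra! hc
    have := Nat.mul_le_mul_left (4 ^ (k + 1)) hc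
    omega
  obtain ⟨d, rfl⟩ : ∃ d, t = s + d := ⟨t - s, by omega⟩
  obtain ⟨N, hN⟩ : ∃ N, N = 4 ^ (k + 1) * (s + d) := ⟨_, rfl⟩
  obtain ⟨q, hq⟩ : ∃ q, q = 4 ^ (k + 1) * s := ⟨_, rfl⟩
  obtain ⟨D, hD⟩ : ∃ D, D = 4 ^ (k + 1) * d := ⟨_, rfl⟩
  have hNq : N = q + D := by rw [hN, hq, hD, mul_add]
  rw [← hN] at h hlen hx hH hH'
  rw [← hq] at h hlen
  by_cases h0 : x + q + 6 * s ≤ N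
  · refine rulerLetter_window_ne (k := k) (H := H) (y₀ := x) hs le_rfl fun y hy1 hy2 => ?_
    have := h (y - x) (by omega)
    rw [show x + (y - x) = y by omega, show x + q + (y - x) = y + q by omega,
      Nat.mod_eq_of_lt (by omega), Nat.mod_eq_of_lt (by omega)] at this
    rwa [← hq]
  by_cases h2 : N ≤ x + e - 6 * s
  · refine rulerLetter_window_ne (k := k) (H := H) (y₀ := x + e - 6 * s - N) hs le_rfl
      fun y hy1 hy2 => ?_
    have := h (y + N - x) (by omega)
    rw [show x + (y + N - x) = y + N by omega, show x + q + (y + N - x) = y + q + N by omega,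
      Nat.add_mod_right, Nat.add_mod_right,
      Nat.mod_eq_of_lt (by omega), Nat.mod_eq_of_lt (by omega)] at this
    rwa [← hq]
  have hwin : ∀ y, x + 6 * s + q ≤ y + N → y + N < x + 12 * s + q →
      rulerLetter k H y = rulerLetter k H (y + D) := fun y hy1 hy2 => by
    have := h (y + D - x) (by omega)
    rw [show x + (y + D - x) = y + D by omega, show x + q + (y + D - x) = y + N by omega,
      Nat.add_mod_right, Nat.mod_eq_of_lt (by omega), Nat.mod_eq_of_lt (by omega)] at this
    exact this.symm
  have hds : d ≤ s := by
    obtain ⟨y, hy1, hy2, hmod⟩ := exists_modEq_mem_window (x + 6 * s + q - N) 2 4 (by norm_num)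
    unfold Nat.ModEq at hmod
    have hmark := hwin y (by omega) (by omega)
    have e4 : D = 4 * (4 ^ k * d) := by rw [hD]; ring
    have hDle : D ≤ q + 24 := by
      unfold rulerLetter at hmark
      rw [if_neg (show ¬ y % 4 = 0 by omega), if_neg (show ¬ y % 2 = 1 by omega),
        if_neg (show ¬ (y + D) % 4 = 0 by omega), if_neg (show ¬ (y + D) % 2 = 1 by omega)] at hmark
      split_ifs at hmark <;> omega
    by_contra! hlt
    have h1 : 4 ^ (k + 1) * (s + 1) ≤ 4 ^ (k + 1) * d := Nat.mul_le_mul_left _ hlt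
    have h3 : 4 ^ 5 ≤ 4 ^ (k + 1) := Nat.pow_le_pow_right (by norm_num) (by omega)
    rw [mul_add] at h1
    omega
  refine rulerLetter_window_ne (k := k) (H := H) (y₀ := x + 6 * s + q - N) (by omega) hds
    fun y hy1 hy2 => ?_
  rw [← hD]
  exact hwin y (by omega) (by omega)

lemma twenty_mul_le_pow {k : ℕ} (hk : 4 ≤ k) : 20 * (6 * k + 25) ≤ 4 ^ (k + 1) := by
  induction k, hk using Nat.le_induction with
  | base => norm_num
  | succ k _ ih => rw [pow_succ]; omega

lemma card_filter_dvd_range {d N : ℕ} (hd : 0 < d) (h : d ∣ N) :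
    ((Finset.range N).filter (d ∣ ·)).card = N / d := by
  obtain ⟨c, rfl⟩ := h
  have := card_filter_dvd_Ico d 0 (d * c) hd
  rw [zero_add, zero_add, Nat.div_eq_of_lt (show d - 1 < d by omega), add_zero,
    Nat.add_sub_assoc hd, Nat.mul_add_div hd, Nat.div_eq_of_lt (show d - 1 < d by omega),
    add_zero, ← Finset.range_eq_Ico] at this
  rw [this, Nat.mul_div_cancel_left _ hd]

lemma card_filter_mod_four_eq_two (h : ℕ) :
    ((Finset.range (4 * h)).filter (fun i => i % 4 = 2)).card = h := by
  induction h with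
  | zero => simp
  | succ h ih =>
    rw [show 4 * (h + 1) = 4 * h + 1 + 1 + 1 + 1 by ring]
    simp only [Finset.range_add_one, Finset.filter_insert]
    rw [if_neg (by omega), if_pos (by omega), if_neg (by omega), if_neg (by omega),
      Finset.card_insert_of_notMem (by simp), ih]

lemma card_filter_rulerLetter_eq_one {k h N : ℕ} (hh : 4 * h ≤ N) :
    ((Finset.range N).filter (fun i => rulerLetter k (4 * h) i = 1)).card =
      ((Finset.range N).filter (fun i => i % 2 = 1 ∧ lastTernaryDigit i = 1)).card + h := by
  conv_rhs => rw [← card_filter_mod_four_eq_two h]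
  rw [← Finset.card_union_of_disjoint]
  · congr 1
    ext i
    simp only [Finset.mem_filter, Finset.mem_union, Finset.mem_range]
    unfold rulerLetter
    split_ifs <;> omega
  · rw [Finset.disjoint_left]
    intro i h1 h2
    simp only [Finset.mem_filter] at h1 h2
    omega

/-- A suitable position of the marker change makes every letter count divisible by four. -/
lemma exists_four_dvd_count_rulerLetter (k t : ℕ) (hk : 4 ≤ k) (ht : 1 ≤ t) :
    ∃ H, 4 ^ (k + 1) * t ≤ 2 * H ∧ 2 * H ≤ 4 ^ (k + 1) * t + 24 ∧
      ∀ a, 1 ≤ a → 4 ∣ ((List.range (4 ^ (k + 1) * t)).map (rulerLetter k H)).count a := by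
  obtain ⟨N, hN⟩ : ∃ N, N = 4 ^ (k + 1) * t := ⟨_, rfl⟩
  have hN16 : N = 16 * (4 ^ (k - 1) * t) := by
    obtain ⟨l, rfl⟩ : ∃ l, k = l + 1 := ⟨k - 1, by omega⟩
    rw [hN, Nat.add_sub_cancel]; ring
  have hN24 : 24 ≤ N := by
    have h1 := twenty_mul_le_pow hk
    have h2 : 4 ^ (k + 1) ≤ N := hN ▸ Nat.le_mul_of_pos_right _ ht
    omega
  obtain ⟨C, hC⟩ : ∃ C, C =
    ((Finset.range N).filter (fun i => i % 2 = 1 ∧ lastTernaryDigit i = 1)).card := ⟨_, rfl⟩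
  obtain ⟨h, hN8, hN24', hCh⟩ : ∃ h, N ≤ 8 * h ∧ 8 * h ≤ N + 24 ∧ 4 ∣ C + h := by
    refine ⟨2 * (4 ^ (k - 1) * t) + (4 - (C + 2 * (4 ^ (k - 1) * t)) % 4) % 4, ?_, ?_, ?_⟩ <;> omega
  rw [← hN]
  refine ⟨4 * h, by omega, by omega, fun a ha => ?_⟩
  have hone := card_filter_rulerLetter_eq_one (k := k) (show 4 * h ≤ N by omega)
  rw [← hC] at hone
  have hdvd : ∀ j, j ≤ k → 4 * 4 ^ j ∣ N := fun j hj => by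
    rw [hN, ← pow_succ']
    exact (pow_dvd_pow 4 (by omega)).trans (Dvd.intro _ rfl)
  have hcard : ∀ j, j ≤ k → 4 ∣ ((Finset.range N).filter (4 ^ j ∣ ·)).card := fun j hj => by
    rw [card_filter_dvd_range (by positivity) ((Dvd.intro_left _ rfl).trans (hdvd j hj))]
    exact Nat.dvd_div_of_mul_dvd (by rw [mul_comm]; exact hdvd j hj)
  rw [List.range_eq_range', count_map_range', zero_add, ← Finset.range_eq_Ico]
  rcases (by omega : a = 1 ∨ a = 2 ∨ 3 ≤ a ∧ a ≤ k + 2 ∨ k + 2 < a) with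
    rfl | rfl | ⟨ha3, hak⟩ | hak
  · rwa [hone]
  · have hsum := Finset.card_filter_add_card_filter_not (s := Finset.range N) (fun y => 4 ^ 1 ∣ y)
    have hsplit : ((Finset.range N).filter (fun y => ¬ 4 ^ 1 ∣ y)).card =
        ((Finset.range N).filter (fun i => rulerLetter k (4 * h) i = 1)).card +
        ((Finset.range N).filter (fun i => rulerLetter k (4 * h) i = 2)).card := by
      rw [← Finset.card_union_of_disjoint]
      · congr 1
        ext i
        simp only [Finset.mem_filter, Finset.mem_union, ← and_or_left, pow_one,
          ← three_le_rulerLetter_iff (k := k) (H := 4 * h) (i := i) (by omega)]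
        have := rulerLetter_mem_Icc k (4 * h) i
        refine and_congr_right fun _ => ?_
        omega
      · rw [Finset.disjoint_left]
        intro i h1 h2
        simp only [Finset.mem_filter] at h1 h2
        omega
    have h4 := hcard 1 (by omega)
    rw [Finset.card_range] at hsum
    omega
  · obtain ⟨j, rfl⟩ : ∃ j, a = j + 2 := ⟨a - 2, by omega⟩
    simp only [rulerLetter_eq_iff (show 1 ≤ j by omega) (show j ≤ k by omega)]
    by_cases hjk : j < k
    · have hsum := card_filter_dvd_add_card_filter_not_dvd (Finset.range N) j
      simp only [hjk, true_imp_iff]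
      have h1 := hcard j (by omega)
      have h2 := hcard (j + 1) (by omega)
      omega
    · simpa [hjk] using hcard j (by omega)
  · rw [Finset.filter_false_of_mem fun i _ => by have := rulerLetter_mem_Icc k (4 * h) i; omega]
    simp

/-- Let `n ≥ 45`, `m = ⌊(n-3)/6⌋`, `M = 4^(m-2)`.  For every `t ≥ 1` there is a word
`w` over `A_m = {1,…,m}` of length `Mt` such that `4 ∣ |w|_a` for every letter
`a ∈ A_m`, and no factor `v` of the circular word `⟨w⟩` is a `ψ_n`-kernel repetition,
i.e. no factor `v` has a period `q` and a factor `v'` of length `q` with `4 ∣ |v'|_a`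
for every `a ∈ A_m` and `(n-1)(|v|+1) ≥ nq - 3`. -/
theorem exists_kernel_word_without_kernel_repetitions
    (n : ℕ) (hn : 45 ≤ n) (t : ℕ) (ht : 1 ≤ t) :
    ∃ w : List ℕ, (∀ a ∈ w, 1 ≤ a ∧ a ≤ (n - 3) / 6) ∧
      w.length = 4 ^ ((n - 3) / 6 - 2) * t ∧
      (∀ a : ℕ, 1 ≤ a → a ≤ (n - 3) / 6 → 4 ∣ w.count a) ∧
      ¬ ∃ (v : List ℕ) (q : ℕ) (v' : List ℕ),
          IsCircularFactor v w ∧ HasPeriod v q ∧ v' <:+: v ∧ v'.length = q ∧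
          (∀ a : ℕ, 1 ≤ a → a ≤ (n - 3) / 6 → 4 ∣ v'.count a) ∧
          n * q ≤ (n - 1) * (v.length + 1) + 3 := by
  obtain ⟨k, hk⟩ : ∃ k, (n - 3) / 6 = k + 3 := ⟨(n - 3) / 6 - 3, by omega⟩
  have hk4 : 4 ≤ k := by omega
  rw [hk, show k + 3 - 2 = k + 1 by omega]
  obtain ⟨H, hH, hH', hcount⟩ := exists_four_dvd_count_rulerLetter k t hk4 ht
  obtain ⟨N, hN⟩ : ∃ N, N = 4 ^ (k + 1) * t := ⟨_, rfl⟩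
  have hpow := twenty_mul_le_pow hk4
  have hNpos : 0 < N := by rw [hN]; positivity
  rw [← hN] at hcount ⊢
  refine ⟨(List.range N).map (rulerLetter k H), ?_, by simp, fun a ha _ => hcount a ha, ?_⟩
  · intro a ha
    obtain ⟨i, -, rfl⟩ := List.mem_map.1 ha
    have := rulerLetter_mem_Icc k H i
    omega
  rintro ⟨v, q, v', hv, ⟨hq0, hper⟩, hv'v, hv'q, hker, hrep⟩
  obtain ⟨hvN, x, hx⟩ := hv.getElem?_eq
  obtain ⟨e, he⟩ : ∃ e, v.length = q + e :=
    ⟨v.length - q, by have := hv'v.length_le; omega⟩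
  have hrep' : q ≤ (6 * k + 25) * (e + 1) + 3 := by
    obtain ⟨r, rfl⟩ : ∃ r, n = r + 1 := ⟨n - 1, by omega⟩
    have hr : r ≤ 6 * k + 25 := by omega
    have := Nat.mul_le_mul_right (e + 1) hr
    rw [he, Nat.add_sub_cancel] at hrep
    nlinarith
  set L : ℕ → ℕ := fun y => rulerLetter k H (y % N) with hLdef
  have hdvdN : ∀ j y, j ≤ k + 1 → (4 ^ j ∣ y % N ↔ 4 ^ j ∣ y) := fun j y hj =>
    Nat.dvd_mod_iff (hN ▸ (pow_dvd_pow 4 hj).trans (Dvd.intro _ rfl))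
  have hL : ∀ y j, 1 ≤ j → j ≤ k →
      (L y = j + 2 ↔ 4 ^ j ∣ y ∧ (j < k → ¬ 4 ^ (j + 1) ∣ y)) := fun y j h1 h2 => by
    rw [hLdef, rulerLetter_eq_iff h1 h2, hdvdN _ _ (by omega), hdvdN _ _ (by omega)]
  obtain ⟨x', hx'⟩ : ∃ x', v' = (List.range' x' q).map L := by
    obtain ⟨S, T, hST⟩ := hv'v
    refine ⟨x + S.length, List.ext_getElem (by simp [hv'q]) fun j hj _ => ?_⟩
    have hlen := congrArg List.length hST
    simp only [List.length_append] at hlen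
    have h1 := hx (S.length + j) (by omega)
    rw [← hST, List.append_assoc, List.getElem?_append_right (by omega),
      List.getElem?_append_left (by omega), Nat.add_sub_cancel_left,
      List.getElem?_eq_getElem hj, Option.some_inj] at h1
    rw [h1]
    simp [hLdef, add_assoc]
  have hg := pow_dvd_card_filter_dvd (L := L) (k := k) (x := x') (q := q) hL
    (fun j h1 h2 => by
      rw [← count_map_range', ← hx']
      exact hker _ (by omega) (by omega)) (k - 1) (by omega)
  rw [show k - (k - 1) = 1 by omega, show k - 1 + 1 = k by omega] at hg
  have hcard := card_filter_dvd_Ico (4 ^ 1) x' q (by norm_num)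
  obtain ⟨s, hs⟩ := hg
  rw [hs] at hcard
  have hM : 4 ^ (k + 1) * s = 4 * (4 ^ k * s) := by ring
  have hs1 : 1 ≤ s := by
    by_contra! hs0
    obtain rfl : s = 0 := by omega
    have hq3 : q ≤ 3 := by omega
    have hmem : v'[0]'(by omega) ∈ v' := List.getElem_mem _
    have h1 := List.count_pos_iff.2 hmem
    have h2 := List.count_le_length (a := v'[0]'(by omega)) (l := v')
    have h3 : 1 ≤ v'[0]'(by omega) ∧ v'[0]'(by omega) ≤ k + 2 := by
      simp only [hx', List.getElem_map, hLdef]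
      exact rulerLetter_mem_Icc _ _ _
    have h4 := hker _ h3.1 (by omega)
    omega
  have hMs : 4 ^ (k + 1) ≤ 4 ^ (k + 1) * s := Nat.le_mul_of_pos_right _ hs1
  have he4 : 4 ≤ e := by
    by_contra! hlt
    have : (6 * k + 25) * (e + 1) ≤ (6 * k + 25) * 4 := Nat.mul_le_mul_left _ (by omega)
    omega
  have hshift : ∀ j < e, L (x + j) = L (x + q + j) := fun j hj => by
    have h1 := hper j (by omega)
    rw [hx _ (by omega), hx _ (by omega), Option.some_inj] at h1
    simp only [hLdef]
    rw [h1, show x + (j + q) = x + q + j by omega]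
  have hq4 : q = 4 ^ (k + 1) * s := by
    obtain ⟨y, hy1, hy2, hmod⟩ := exists_modEq_mem_window x 0 4 (by norm_num)
    unfold Nat.ModEq at hmod
    have h1 := hshift (y - x) (by omega)
    have hdvd4 : ∀ z, 3 ≤ L z ↔ 4 ∣ z := fun z => by
      rw [hLdef, three_le_rulerLetter_iff (by omega)]
      simpa using hdvdN 1 z (by omega)
    have h2 := (hdvd4 (x + (y - x))).2 (by omega)
    rw [h1, hdvd4] at h2
    omega
  have he19 : 19 * s ≤ e + 1 := by
    by_contra! hlt
    have h1 : (6 * k + 25) * (e + 2) ≤ (6 * k + 25) * (19 * s) := Nat.mul_le_mul_left _ (by omega)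
    have h2 := Nat.mul_le_mul_right s hpow
    nlinarith
  have hlen : 4 ^ (k + 1) * s + e ≤ 4 ^ (k + 1) * t := by omega
  refine rulerLetter_circular_window_ne (x := x % N) hk4 hH hH' hs1
    (hN ▸ Nat.mod_lt _ hNpos) he19 hlen fun j hj => ?_
  have := hshift j hj
  rw [← hN, ← hq4]
  simpa [hLdef, add_assoc] using this
end
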